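/- arXiv:math/9702222 — 3 statements merged into one kernel-verified Lean document; each statement's English description precedes it below -/
import Mathlib

section
/- For all positive integers a, b, c, d, the pair D := ({(0,0),(a,b)}, {(0,d),(c,0)}) is an irreducible fill of the pair of rectangles ([0,a]×[0,b], [0,c]×[0,d]) in ℝ²: the points of D_1 lie in the first rectangle, the points of D_2 lie in the second rectangle, the mixed area of (conv D_1, conv D_2) equals the mixed area ad + bc of the pair of rectangles, and no pair D' with D'_i ⊆ D_i for all i and D'_j ⊊ D_j for some j has this property. -/
open MeasureTheory Pointwise

/-- The mixed area of a pair of subsets of `ℝ²`: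
`M(A,B) = vol(A + B) - vol(A) - vol(B)`, `+` being Minkowski sum. -/
noncomputable def mixedArea (A B : Set (ℝ × ℝ)) : ℝ :=
  (volume (A + B)).toReal - (volume A).toReal - (volume B).toReal

theorem mixedArea_comm (A B : Set (ℝ × ℝ)) : mixedArea A B = mixedArea B A := by
  unfold mixedArea
  rw [add_comm A B]
  ring

theorem mixedArea_nonpos_of_subsingleton {A : Set (ℝ × ℝ)} (hA : A.Subsingleton)
    (B : Set (ℝ × ℝ)) : mixedArea A B ≤ 0 := by
  unfold mixedArea
  obtain rfl | ⟨x, rfl⟩ := hA.eq_empty_or_singleton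
  · simp
  · simp [Set.singleton_add, Set.image_add_left, measure_preimage_add]

theorem Set.subsingleton_of_ssubset_pair {α : Type*} {s : Set α} {x y : α}
    (h : s ⊂ {x, y}) : s.Subsingleton := by
  intro u hu v hv
  by_contra huv
  refine h.2 ?_
  have hu' := h.1 hu
  have hv' := h.1 hv
  simp only [Set.mem_insert_iff, Set.mem_singleton_iff] at hu' hv'
  rintro w (rfl | rfl) <;> grind

theorem Set.Subsingleton.convexHull_subsingleton {s : Set (ℝ × ℝ)} (hs : s.Subsingleton) :
    (convexHull ℝ s).Subsingleton := by
  obtain rfl | ⟨x, rfl⟩ := hs.eq_empty_or_singleton <;> simp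

/-- The sum of two segments is a parallelogram, whose area is the absolute value of the
cross product of the edge vectors. -/
theorem volume_segment_add_segment (p q r s : ℝ × ℝ) :
    volume (segment ℝ p q + segment ℝ r s) =
      ENNReal.ofReal |(q.1 - p.1) * (s.2 - r.2) - (s.1 - r.1) * (q.2 - p.2)| := by
  have h : segment ℝ p q + segment ℝ r s = (fun z => (p + r) + z) ''
      (Matrix.toLin (Module.Basis.finTwoProd ℝ) (Module.Basis.finTwoProd ℝ)
        !![q.1 - p.1, s.1 - r.1; q.2 - p.2, s.2 - r.2] ''
          (Set.Icc (0 : ℝ) 1 ×ˢ Set.Icc (0 : ℝ) 1)) := by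
    rw [segment_eq_image', segment_eq_image', ← Set.image2_add, Set.image2_image_left,
      Set.image2_image_right, Set.image_image, ← Set.image_uncurry_prod]
    refine Set.image_congr fun z _ => ?_
    ext <;> simp [Matrix.toLin_finTwoProd_apply, Function.uncurry] <;> ring
  rw [h, Set.image_add_left, measure_preimage_add, Measure.addHaar_image_linearMap,
    LinearMap.det_toLin, Matrix.det_fin_two_of, Measure.volume_eq_prod, Measure.prod_prod]
  simp

theorem volume_segment_prod (p q : ℝ × ℝ) : volume (segment ℝ p q) = 0 := by
  have h := volume_segment_add_segment p q 0 0
  simpa [segment_same] using h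

theorem mixedArea_segment_segment (p q r s : ℝ × ℝ) :
    mixedArea (segment ℝ p q) (segment ℝ r s) =
      |(q.1 - p.1) * (s.2 - r.2) - (s.1 - r.1) * (q.2 - p.2)| := by
  simp [mixedArea, volume_segment_add_segment, volume_segment_prod]

theorem Icc_zero_add_Icc_zero {a c : ℝ} (ha : 0 ≤ a) (hc : 0 ≤ c) :
    Set.Icc 0 a + Set.Icc 0 c = Set.Icc 0 (a + c) := by
  ext x
  simp only [Set.mem_add, Set.mem_Icc]
  constructor
  · rintro ⟨y, ⟨hy, hya⟩, z, ⟨hz, hzc⟩, rfl⟩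
    exact ⟨add_nonneg hy hz, add_le_add hya hzc⟩
  · rintro ⟨hx, hxac⟩
    refine ⟨min x a, ⟨le_min hx ha, min_le_right x a⟩, x - min x a,
      ⟨sub_nonneg.mpr (min_le_left x a), ?_⟩, by ring⟩
    grind

theorem mixedArea_rectangle_rectangle {a b c d : ℝ} (ha : 0 ≤ a) (hb : 0 ≤ b) (hc : 0 ≤ c)
    (hd : 0 ≤ d) :
    mixedArea (Set.Icc 0 a ×ˢ Set.Icc 0 b) (Set.Icc 0 c ×ˢ Set.Icc 0 d) = a * d + b * c := by
  have hadd : (Set.Icc 0 a ×ˢ Set.Icc 0 b) + (Set.Icc 0 c ×ˢ Set.Icc 0 d) =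
      Set.Icc 0 (a + c) ×ˢ Set.Icc 0 (b + d) := by
    rw [Set.prod_add_prod_comm, Icc_zero_add_Icc_zero ha hc, Icc_zero_add_Icc_zero hb hd]
  simp only [mixedArea, hadd, Measure.volume_eq_prod, Measure.prod_prod, Real.volume_Icc,
    sub_zero, ENNReal.toReal_mul]
  rw [ENNReal.toReal_ofReal ha, ENNReal.toReal_ofReal hb, ENNReal.toReal_ofReal hc,
    ENNReal.toReal_ofReal hd, ENNReal.toReal_ofReal (add_nonneg ha hc),
    ENNReal.toReal_ofReal (add_nonneg hb hd)]
  ring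

/-- The pair `D = ({(0,0),(a,b)}, {(0,d),(c,0)})` is an irreducible fill of the pair of
rectangles `([0,a]×[0,b], [0,c]×[0,d])`: the points of `D₁`, `D₂` lie in the respective
rectangles, `M(conv D₁, conv D₂) = M(R₁, R₂) = ad + bc`, and no pair obtained by strictly
shrinking some `Dᵢ` still has mixed area of convex hulls equal to `M(R₁, R₂)`. -/
theorem diagonals_irreducibly_fill_rectangles (a b c d : ℕ) (ha : 0 < a) (hb : 0 < b)
    (hc : 0 < c) (hd : 0 < d) :
    (({((0:ℝ), (0:ℝ)), ((a:ℝ), (b:ℝ))} : Set (ℝ × ℝ)) ⊆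
        Set.Icc (0:ℝ) a ×ˢ Set.Icc (0:ℝ) b) ∧
    (({((0:ℝ), (d:ℝ)), ((c:ℝ), (0:ℝ))} : Set (ℝ × ℝ)) ⊆
        Set.Icc (0:ℝ) c ×ˢ Set.Icc (0:ℝ) d) ∧
    mixedArea (Set.Icc (0:ℝ) a ×ˢ Set.Icc (0:ℝ) b) (Set.Icc (0:ℝ) c ×ˢ Set.Icc (0:ℝ) d)
      = a * d + b * c ∧
    mixedArea (convexHull ℝ {((0:ℝ), (0:ℝ)), ((a:ℝ), (b:ℝ))})
        (convexHull ℝ {((0:ℝ), (d:ℝ)), ((c:ℝ), (0:ℝ))})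
      = mixedArea (Set.Icc (0:ℝ) a ×ˢ Set.Icc (0:ℝ) b)
          (Set.Icc (0:ℝ) c ×ˢ Set.Icc (0:ℝ) d) ∧
    ∀ D₁' D₂' : Set (ℝ × ℝ),
      D₁' ⊆ ({((0:ℝ), (0:ℝ)), ((a:ℝ), (b:ℝ))} : Set (ℝ × ℝ)) →
      D₂' ⊆ ({((0:ℝ), (d:ℝ)), ((c:ℝ), (0:ℝ))} : Set (ℝ × ℝ)) →
      (D₁' ⊂ ({((0:ℝ), (0:ℝ)), ((a:ℝ), (b:ℝ))} : Set (ℝ × ℝ)) ∨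
        D₂' ⊂ ({((0:ℝ), (d:ℝ)), ((c:ℝ), (0:ℝ))} : Set (ℝ × ℝ))) →
      mixedArea (convexHull ℝ D₁') (convexHull ℝ D₂') ≠
        mixedArea (Set.Icc (0:ℝ) a ×ˢ Set.Icc (0:ℝ) b)
          (Set.Icc (0:ℝ) c ×ˢ Set.Icc (0:ℝ) d) := by
  have hrect := mixedArea_rectangle_rectangle (Nat.cast_nonneg (α := ℝ) a)
    (Nat.cast_nonneg b) (Nat.cast_nonneg c) (Nat.cast_nonneg d)
  have hpos : (0 : ℝ) < a * d + b * c := by positivity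
  refine ⟨?_, ?_, hrect, ?_, ?_⟩
  · simp [Set.insert_subset_iff]
  · simp [Set.insert_subset_iff]
  · rw [hrect, convexHull_pair, convexHull_pair, mixedArea_segment_segment, abs_of_nonpos]
    · ring
    · nlinarith
  · intro D₁' D₂' _ _ h
    rw [hrect]
    refine (lt_of_le_of_lt ?_ hpos).ne
    rcases h with h | h
    · exact mixedArea_nonpos_of_subsingleton
        (Set.subsingleton_of_ssubset_pair h).convexHull_subsingleton _
    · rw [mixedArea_comm]
      exact mixedArea_nonpos_of_subsingleton
        (Set.subsingleton_of_ssubset_pair h).convexHull_subsingleton _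
end

section
/- The triple D := ({(0,0,0),(1,1,1)}, {(1,0,0),(0,1,0),(0,0,1)}, {(1,1,0),(1,0,1),(0,1,1)}) is an irreducible fill of the triple (Q,Q,Q), where Q = [0,1]³ is the standard unit cube in ℝ³: each D_i ⊆ Q, the mixed volume M(conv D_1, conv D_2, conv D_3) equals M(Q,Q,Q) = 6, and no triple D' with D'_i ⊆ D_i for all i and D'_j ⊊ D_j for some j has this property. -/
open MeasureTheory Pointwise

/-- The normalized mixed volume of a triple of subsets of `ℝ³`:
`M(A,B,C) = vol(A+B+C) - vol(A+B) - vol(A+C) - vol(B+C) + vol(A) + vol(B) + vol(C)`. -/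
noncomputable def mixedVol3 (A B C : Set (Fin 3 → ℝ)) : ℝ :=
  (volume (A + B + C)).toReal - (volume (A + B)).toReal - (volume (A + C)).toReal
    - (volume (B + C)).toReal + (volume A).toReal + (volume B).toReal + (volume C).toReal

/-- The closed region between two continuous functions over `[a, b]`. -/
theorem volume_closed_region_between {a b : ℝ} (hab : a ≤ b) {f g : ℝ → ℝ}
    (hf : Continuous f) (hg : Continuous g) (hfg : ∀ p ∈ Set.Icc a b, f p ≤ g p) :
    volume {r : ℝ × ℝ | r.1 ∈ Set.Icc a b ∧ r.2 ∈ Set.Icc (f r.1) (g r.1)}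
      = ENNReal.ofReal (∫ p in a..b, (g p - f p)) := by
  have hm : MeasurableSet {r : ℝ × ℝ | r.1 ∈ Set.Icc a b ∧ r.2 ∈ Set.Icc (f r.1) (g r.1)} := by
    apply IsClosed.measurableSet
    simp only [Set.mem_Icc]
    apply IsClosed.inter
    · exact (isClosed_le continuous_const continuous_fst).inter
        (isClosed_le continuous_fst continuous_const)
    · exact (isClosed_le (hf.comp continuous_fst) continuous_snd).inter
        (isClosed_le continuous_snd (hg.comp continuous_fst))
  rw [Measure.volume_eq_prod, Measure.prod_apply hm, intervalIntegral.integral_of_le hab,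
    ← integral_Icc_eq_integral_Ioc, ofReal_integral_eq_lintegral_ofReal,
    ← lintegral_indicator measurableSet_Icc]
  · congr 1 with p
    by_cases hp : p ∈ Set.Icc a b
    · rw [Set.indicator_of_mem hp, ← Real.volume_Icc]
      congr 1 with q
      simp [hp.1, hp.2]
    · rw [Set.indicator_of_notMem hp]
      convert measure_empty (μ := volume)
      ext q
      simp only [Set.mem_preimage, Set.mem_ofPred_eq, hp, false_and, Set.mem_empty_iff_false]
  · exact (hg.sub hf).continuousOn.integrableOn_Icc
  · filter_upwards [ae_restrict_mem measurableSet_Icc] with p hp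
    exact sub_nonneg.2 (hfg p hp)

theorem volume_linear_level (f : (Fin 3 → ℝ) →ₗ[ℝ] ℝ) (hf : f ≠ 0) (c : ℝ) :
    volume {x | f x = c} = 0 := by
  obtain h | ⟨y, hy⟩ := Set.eq_empty_or_nonempty {x | f x = c}
  · rw [h, measure_empty]
  · have h : {x | f x = c} = (fun x => x + -y) ⁻¹' (LinearMap.ker f : Set (Fin 3 → ℝ)) := by
      ext x
      simp only [Set.mem_ofPred_eq] at hy
      simp [hy, ← sub_eq_add_neg, sub_eq_zero]
    rw [h, measure_preimage_add_right]
    exact Measure.addHaar_submodule _ _ (by rwa [Ne, LinearMap.ker_eq_top])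

theorem volume_sum_level (c : ℝ) : volume {x : Fin 3 → ℝ | x 0 + x 1 + x 2 = c} = 0 := by
  have h := volume_linear_level (∑ i, LinearMap.proj i) (fun h => by
    have := LinearMap.congr_fun h 1
    simp [LinearMap.sum_apply] at this) c
  simpa [LinearMap.sum_apply, Fin.sum_univ_three] using h

theorem mixedVol3_cube : mixedVol3 (Set.Icc (0 : Fin 3 → ℝ) 1) (Set.Icc (0 : Fin 3 → ℝ) 1)
      (Set.Icc (0 : Fin 3 → ℝ) 1) = 6 := by
  set Q := Set.Icc (0 : Fin 3 → ℝ) 1 with hQ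
  have hc : Convex ℝ Q := convex_Icc _ _
  have h2 : Q + Q = (2 : ℝ) • Q := by
    have := hc.add_smul zero_le_one zero_le_one
    simpa [one_add_one_eq_two] using this.symm
  have h3 : Q + Q + Q = (3 : ℝ) • Q := by
    have := hc.add_smul zero_le_two zero_le_one
    rw [h2]
    norm_num at this
    exact this.symm
  have h1 : volume Q = 1 := by
    rw [hQ, Real.volume_Icc_pi]
    simp
  rw [mixedVol3, h3, h2, Measure.addHaar_smul, Measure.addHaar_smul, h1]
  norm_num

/-- Shearing a prism with axis `(1, 1, 1)` to a product. -/
theorem volume_prism (k : ℝ) (P : Set (ℝ × ℝ)) :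
    volume {x : Fin 3 → ℝ | x 0 + x 1 + x 2 ∈ Set.Icc k (k + 3) ∧
      (x 0 - (x 0 + x 1 + x 2) / 3, x 1 - (x 0 + x 1 + x 2) / 3) ∈ P} = 3 * volume P := by
  let M : Matrix (Fin 3) (Fin 3) ℝ := !![1, 1, 1; 2/3, -1/3, -1/3; -1/3, 2/3, -1/3]
  have hM : (Matrix.toLin' M).det = 1 := by
    rw [LinearMap.det_toLin', Matrix.det_fin_three]
    simp only [M, Matrix.of_apply, Matrix.cons_val]
    norm_num
  have h := Measure.addHaar_preimage_linearMap (volume : Measure (Fin 3 → ℝ))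
    (f := Matrix.toLin' M) (by rw [hM]; exact one_ne_zero)
    {u | u 0 ∈ Set.Icc k (k + 3) ∧ (u 1, u 2) ∈ P}
  have h' := (volume_preserving_piFinSuccAbove (fun _ : Fin 3 => ℝ) 0).measure_preimage_equiv
    (Set.Icc k (k + 3) ×ˢ ((MeasurableEquiv.finTwoArrow : (Fin 2 → ℝ) ≃ᵐ ℝ × ℝ) ⁻¹' P))
  rw [Measure.volume_eq_prod, Measure.prod_prod,
    (volume_preserving_finTwoArrow ℝ).measure_preimage_equiv, Real.volume_Icc] at h'
  have e3 : ENNReal.ofReal (k + 3 - k) = 3 := by norm_num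
  rw [e3] at h'
  rw [← h']
  rw [hM, inv_one, abs_one, ENNReal.ofReal_one, one_mul] at h
  rw [show (MeasurableEquiv.piFinSuccAbove (fun _ : Fin 3 => ℝ) 0) ⁻¹' (Set.Icc k (k + 3) ×ˢ
    ((MeasurableEquiv.finTwoArrow : (Fin 2 → ℝ) ≃ᵐ ℝ × ℝ) ⁻¹' P)) =
    {u | u 0 ∈ Set.Icc k (k + 3) ∧ (u 1, u 2) ∈ P} from rfl, ← h]
  congr 1
  ext x
  simp only [Set.mem_ofPred_eq, Set.mem_preimage, Matrix.toLin'_apply, M, Matrix.mulVec,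
    dotProduct, Fin.sum_univ_three, Matrix.of_apply, Matrix.cons_val]
  ring_nf

theorem area_hexagon :
    volume {r : ℝ × ℝ | |r.1| ≤ 1 ∧ |r.2| ≤ 1 ∧ |r.1 + r.2| ≤ 1} = 3 := by
  have h := volume_closed_region_between (a := -1) (b := 1) (by norm_num)
    (f := fun p => max (-1) (-1 - p)) (g := fun p => min 1 (1 - p))
    (by fun_prop) (by fun_prop) (fun p hp => by
      obtain ⟨h1, h2⟩ := hp
      simp only [le_min_iff, max_le_iff]
      refine ⟨⟨?_, ?_⟩, ?_, ?_⟩ <;> linarith)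
  have hi : ∫ p in (-1 : ℝ)..1, (min 1 (1 - p) - max (-1) (-1 - p)) = 3 := by
    rw [← intervalIntegral.integral_add_adjacent_intervals (b := 0)
      (by apply Continuous.intervalIntegrable; fun_prop)
      (by apply Continuous.intervalIntegrable; fun_prop)]
    have h1 : ∫ p in (-1 : ℝ)..0, (min 1 (1 - p) - max (-1) (-1 - p)) =
        ∫ p in (-1 : ℝ)..0, (2 + p) := by
      apply intervalIntegral.integral_congr
      intro p hp
      rw [Set.uIcc_of_le (by norm_num)] at hp
      obtain ⟨hp1, hp2⟩ := hp
      simp only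
      rw [min_eq_left (by linarith), max_eq_right (by linarith)]
      ring
    have h2 : ∫ p in (0 : ℝ)..1, (min 1 (1 - p) - max (-1) (-1 - p)) =
        ∫ p in (0 : ℝ)..1, (2 - p) := by
      apply intervalIntegral.integral_congr
      intro p hp
      rw [Set.uIcc_of_le (by norm_num)] at hp
      obtain ⟨hp1, hp2⟩ := hp
      simp only
      rw [min_eq_right (by linarith), max_eq_left (by linarith)]
      ring
    rw [h1, h2, intervalIntegral.integral_add (by simp) (by simp),
      intervalIntegral.integral_sub (by simp) (by simp)]
    norm_num
  rw [hi] at h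
  convert h using 2
  · ext r
    simp only [Set.mem_ofPred_eq, Set.mem_Icc, abs_le, le_min_iff, max_le_iff]
    grind
  · norm_num

theorem area_triangle :
    volume {r : ℝ × ℝ | -1/3 ≤ r.1 ∧ -1/3 ≤ r.2 ∧ r.1 + r.2 ≤ 1/3} = ENNReal.ofReal (1/2) := by
  have h := volume_closed_region_between (a := -1/3) (b := 2/3) (by norm_num)
    (f := fun _ => -1/3) (g := fun p => 1/3 - p)
    (by fun_prop) (by fun_prop) (fun p hp => by linarith [hp.2])
  have hi : ∫ p in (-1/3 : ℝ)..(2/3), ((1/3 - p) - (-1/3)) = 1/2 := by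
    rw [intervalIntegral.integral_sub (by apply Continuous.intervalIntegrable; fun_prop) (by simp),
      intervalIntegral.integral_sub (by simp) (by simp)]
    norm_num
  rw [hi] at h
  rw [← h]
  congr 1
  ext r
  simp only [Set.mem_ofPred_eq, Set.mem_Icc]
  grind

theorem area_opposite_triangle :
    volume {r : ℝ × ℝ | r.1 ≤ 1/3 ∧ r.2 ≤ 1/3 ∧ -1/3 ≤ r.1 + r.2} = ENNReal.ofReal (1/2) := by
  rw [← area_triangle, ← Measure.measure_neg]
  congr 1
  ext r
  simp only [Set.mem_ofPred_eq, Set.mem_neg, Prod.fst_neg, Prod.snd_neg]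
  grind

theorem convexHull_diagonal : convexHull ℝ {![(0:ℝ),0,0], ![1,1,1]} =
    {x | ∃ t ∈ Set.Icc (0 : ℝ) 1, x = fun _ => t} := by
  rw [convexHull_pair, segment_eq_image']
  ext x
  simp only [Set.mem_image, Set.mem_ofPred_eq]
  refine exists_congr fun t => and_congr_right fun _ => ?_
  rw [eq_comm]
  simp [funext_iff, Fin.forall_fin_succ]

theorem convexHull_lower_triangle : convexHull ℝ {![(1:ℝ),0,0], ![0,1,0], ![0,0,1]} =
    {x | 0 ≤ x 0 ∧ 0 ≤ x 1 ∧ 0 ≤ x 2 ∧ x 0 + x 1 + x 2 = 1} := by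
  apply subset_antisymm
  · apply convexHull_min
    · rintro x (rfl | rfl | rfl) <;> simp
    · intro x hx y hy a b ha hb hab
      obtain ⟨h0, h1, h2, h3⟩ := hx
      obtain ⟨k0, k1, k2, k3⟩ := hy
      simp only [Set.mem_ofPred_eq, Pi.add_apply, Pi.smul_apply, smul_eq_mul]
      refine ⟨by positivity, by positivity, by positivity, ?_⟩
      linear_combination a * h3 + b * k3 + hab
  · rintro x ⟨h0, h1, h2, h3⟩
    rw [show x = ∑ i, x i • (![![(1:ℝ),0,0], ![0,1,0], ![0,0,1]] : Fin 3 → Fin 3 → ℝ) i by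
      simp [funext_iff, Fin.forall_fin_succ, Fin.sum_univ_three]]
    apply (convex_convexHull ℝ _).sum_mem
    · simp [Fin.forall_fin_succ, h0, h1, h2]
    · rw [Fin.sum_univ_three, h3]
    · intro i _
      apply subset_convexHull
      fin_cases i <;> simp

theorem convexHull_upper_triangle : convexHull ℝ {![(1:ℝ),1,0], ![1,0,1], ![0,1,1]} =
    {x | x 0 ≤ 1 ∧ x 1 ≤ 1 ∧ x 2 ≤ 1 ∧ x 0 + x 1 + x 2 = 2} := by
  apply subset_antisymm
  · apply convexHull_min
    · rintro x (rfl | rfl | rfl) <;> simp <;> norm_num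
    · intro x hx y hy a b ha hb hab
      obtain ⟨h0, h1, h2, h3⟩ := hx
      obtain ⟨k0, k1, k2, k3⟩ := hy
      simp only [Set.mem_ofPred_eq, Pi.add_apply, Pi.smul_apply, smul_eq_mul]
      refine ⟨by nlinarith, by nlinarith, by nlinarith, ?_⟩
      linear_combination a * h3 + b * k3 + 2 * hab
  · rintro x ⟨h0, h1, h2, h3⟩
    rw [show x = ∑ i, (1 - x i) •
        (![![(0:ℝ),1,1], ![1,0,1], ![1,1,0]] : Fin 3 → Fin 3 → ℝ) i by
      simp [funext_iff, Fin.forall_fin_succ, Fin.sum_univ_three]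
      refine ⟨?_, ?_, ?_⟩ <;> linarith]
    apply (convex_convexHull ℝ _).sum_mem
    · simp [Fin.forall_fin_succ, h0, h1, h2]
    · rw [Fin.sum_univ_three]
      linarith
    · intro i _
      apply subset_convexHull
      fin_cases i <;> simp

theorem diagonal_add {X : Set (Fin 3 → ℝ)} {k : ℝ} (hX : ∀ x ∈ X, x 0 + x 1 + x 2 = k) :
    convexHull ℝ {![(0:ℝ),0,0], ![1,1,1]} + X =
      {x | x 0 + x 1 + x 2 ∈ Set.Icc k (k + 3) ∧
        (fun i => x i - (x 0 + x 1 + x 2 - k) / 3) ∈ X} := by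
  rw [convexHull_diagonal]
  ext x
  constructor
  · rintro ⟨_, ⟨t, ht, rfl⟩, y, hy, rfl⟩
    have := hX y hy
    refine ⟨?_, ?_⟩
    · simp only [Pi.add_apply]
      constructor <;> linarith [ht.1, ht.2]
    · convert hy using 1
      ext i
      simp only [Pi.add_apply]
      linarith
  · rintro ⟨hs, hx⟩
    refine ⟨_, ⟨(x 0 + x 1 + x 2 - k) / 3, ?_, rfl⟩, _, hx, ?_⟩
    · constructor <;> linarith [hs.1, hs.2]
    · ext i
      simp

theorem lower_add_upper_triangle :
    convexHull ℝ {![(1:ℝ),0,0], ![0,1,0], ![0,0,1]} +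
      convexHull ℝ {![(1:ℝ),1,0], ![1,0,1], ![0,1,1]} =
    {x | x 0 ∈ Set.Icc 0 2 ∧ x 1 ∈ Set.Icc 0 2 ∧ x 2 ∈ Set.Icc 0 2 ∧ x 0 + x 1 + x 2 = 3} := by
  rw [convexHull_lower_triangle, convexHull_upper_triangle]
  ext x
  constructor
  · rintro ⟨y, ⟨h0, h1, h2, h3⟩, z, ⟨k0, k1, k2, k3⟩, rfl⟩
    simp only [Set.mem_ofPred_eq, Set.mem_Icc, Pi.add_apply]
    refine ⟨⟨?_, ?_⟩, ⟨?_, ?_⟩, ⟨?_, ?_⟩, ?_⟩ <;> linarith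
  · rintro ⟨⟨h0, k0⟩, ⟨h1, k1⟩, ⟨h2, k2⟩, h⟩
    have hm : max 0 (x 0 - 1) ≤ 1 - max 0 (x 1 - 1) - max 0 (x 2 - 1) := by grind
    have m0 := max_le_iff.1 hm
    have l1 := le_max_left 0 (x 1 - 1)
    have l2 := le_max_left 0 (x 2 - 1)
    have r1 := le_max_right 0 (x 1 - 1)
    have r2 := le_max_right 0 (x 2 - 1)
    set m1 := max 0 (x 1 - 1)
    set m2 := max 0 (x 2 - 1)
    refine ⟨![1 - m1 - m2, m1, m2], ?_, x - ![1 - m1 - m2, m1, m2], ?_, add_sub_cancel _ _⟩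
    · simp only [Set.mem_ofPred_eq, Matrix.cons_val]
      refine ⟨?_, ?_, ?_, ?_⟩ <;> linarith
    · simp only [Set.mem_ofPred_eq, Pi.sub_apply, Matrix.cons_val]
      refine ⟨?_, ?_, ?_, ?_⟩ <;> linarith

theorem volume_diagonal_add {X : Set (Fin 3 → ℝ)} {k : ℝ}
    (hX : ∀ x ∈ X, x 0 + x 1 + x 2 = k) (P : Set (ℝ × ℝ))
    (hP : ∀ x : Fin 3 → ℝ, x 0 + x 1 + x 2 = k → (x ∈ X ↔ (x 0 - k / 3, x 1 - k / 3) ∈ P)) :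
    volume (convexHull ℝ {![(0:ℝ),0,0], ![1,1,1]} + X) = 3 * volume P := by
  rw [diagonal_add hX, ← volume_prism k]
  congr 1
  ext x
  refine and_congr_right fun _ => ?_
  rw [hP _ (by ring)]
  ring_nf

theorem volume_diagonal_add_lower_triangle :
    volume (convexHull ℝ {![(0:ℝ),0,0], ![1,1,1]} +
      convexHull ℝ {![(1:ℝ),0,0], ![0,1,0], ![0,0,1]}) = ENNReal.ofReal (3/2) := by
  rw [convexHull_lower_triangle, volume_diagonal_add (fun x hx => hx.2.2.2) _ _, area_triangle,
    ← ENNReal.ofReal_ofNat, ← ENNReal.ofReal_mul (by norm_num)]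
  · norm_num
  · intro x hx
    simp only [Set.mem_ofPred_eq]
    grind

theorem volume_diagonal_add_upper_triangle :
    volume (convexHull ℝ {![(0:ℝ),0,0], ![1,1,1]} +
      convexHull ℝ {![(1:ℝ),1,0], ![1,0,1], ![0,1,1]}) = ENNReal.ofReal (3/2) := by
  rw [convexHull_upper_triangle, volume_diagonal_add (fun x hx => hx.2.2.2) _ _,
    area_opposite_triangle, ← ENNReal.ofReal_ofNat, ← ENNReal.ofReal_mul (by norm_num)]
  · norm_num
  · intro x hx
    simp only [Set.mem_ofPred_eq]
    grind

theorem volume_diagonal_add_triangles :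
    volume (convexHull ℝ {![(0:ℝ),0,0], ![1,1,1]} +
      convexHull ℝ {![(1:ℝ),0,0], ![0,1,0], ![0,0,1]} +
      convexHull ℝ {![(1:ℝ),1,0], ![1,0,1], ![0,1,1]}) = 9 := by
  rw [add_assoc, lower_add_upper_triangle, volume_diagonal_add (fun x hx => hx.2.2.2) _ _,
    area_hexagon]
  · norm_num
  · intro x hx
    simp only [Set.mem_ofPred_eq, Set.mem_Icc, abs_le]
    grind

/-- Central symmetry cuts the hexagonal prism into two halves of equal volume. -/
theorem volume_half_prism (i : Fin 3) (H : Set (Fin 3 → ℝ))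
    (hH : H = convexHull ℝ {![(0:ℝ),0,0], ![1,1,1]} +
      convexHull ℝ {![(1:ℝ),0,0], ![0,1,0], ![0,0,1]} +
      convexHull ℝ {![(1:ℝ),1,0], ![1,0,1], ![0,1,1]}) :
    volume (H ∩ {x | x i ≤ (x 0 + x 1 + x 2) / 3}) = ENNReal.ofReal (9/2) ∧
      volume (H ∩ {x | (x 0 + x 1 + x 2) / 3 ≤ x i}) = ENNReal.ofReal (9/2) := by
  have hv := volume_diagonal_add_triangles
  rw [← hH] at hv
  rw [add_assoc, lower_add_upper_triangle, diagonal_add (fun x hx => hx.2.2.2)] at hH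
  have hsymm : volume (H ∩ {x | x i ≤ (x 0 + x 1 + x 2) / 3}) =
      volume (H ∩ {x | (x 0 + x 1 + x 2) / 3 ≤ x i}) := by
    rw [← (Measure.measurePreserving_sub_left volume (3 : Fin 3 → ℝ)).measure_preimage_emb
      (MeasurableEquiv.subLeft 3).measurableEmbedding]
    congr 1
    ext x
    simp only [hH, Set.mem_preimage, Set.mem_inter_iff, Set.mem_ofPred_eq, Set.mem_Icc,
      Pi.sub_apply, Pi.ofNat_apply]
    grind
  have hnull : volume ({x : Fin 3 → ℝ | x i = (x 0 + x 1 + x 2) / 3}) = 0 := by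
    have h := volume_linear_level
      (LinearMap.proj i - (1 / 3 : ℝ) • ∑ j, LinearMap.proj j) (fun h => by
        have := LinearMap.congr_fun h (Pi.single i 1)
        simp [LinearMap.sum_apply] at this
        norm_num at this) 0
    simpa [LinearMap.sum_apply, Fin.sum_univ_three, sub_eq_zero, div_eq_inv_mul, mul_add] using h
  have hm : MeasurableSet {x : Fin 3 → ℝ | (x 0 + x 1 + x 2) / 3 ≤ x i} :=
    (isClosed_le (by fun_prop) (by fun_prop)).measurableSet
  have hsum := measure_inter_add_sdiff (μ := volume) H hm
  have hdiff : volume (H \ {x | (x 0 + x 1 + x 2) / 3 ≤ x i}) =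
      volume (H ∩ {x | x i ≤ (x 0 + x 1 + x 2) / 3}) := by
    apply le_antisymm
    · apply measure_mono
      rintro x ⟨hx, hx'⟩
      rw [Set.mem_ofPred_eq, not_le] at hx'
      exact ⟨hx, hx'.le⟩
    · rw [← add_zero (volume (H \ _)), ← hnull]
      refine (measure_mono ?_).trans (measure_union_le _ _)
      rintro x ⟨hx, hx'⟩
      rw [Set.mem_ofPred_eq] at hx'
      rcases hx'.eq_or_lt with h | h
      · exact Or.inr h
      · exact Or.inl ⟨hx, fun h' => absurd h (not_lt.2 h')⟩
  rw [hdiff, hsymm, hv, ← two_mul] at hsum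
  have : volume (H ∩ {x | (x 0 + x 1 + x 2) / 3 ≤ x i}) = ENNReal.ofReal (9/2) := by
    rw [← ENNReal.mul_right_inj (a := 2) (by norm_num) (by norm_num), hsum,
      ← ENNReal.ofReal_ofNat, ← ENNReal.ofReal_ofNat, ← ENNReal.ofReal_mul (by norm_num)]
    norm_num
  exact ⟨hsymm.trans this, this⟩

theorem volume_convexHull_diagonal :
    volume (convexHull ℝ {![(0:ℝ),0,0], ![1,1,1]}) = 0 := by
  have h := volume_linear_level (.proj 0 - .proj 1) (fun h => by
    have := LinearMap.congr_fun h (Pi.single 0 1)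
    simp [LinearMap.sub_apply] at this) 0
  refine measure_mono_null ?_ h
  rw [convexHull_diagonal]
  rintro _ ⟨t, _, rfl⟩
  simp [LinearMap.sub_apply]

theorem volume_convexHull_lower_triangle :
    volume (convexHull ℝ {![(1:ℝ),0,0], ![0,1,0], ![0,0,1]}) = 0 := by
  rw [convexHull_lower_triangle]
  exact measure_mono_null (fun x hx => hx.2.2.2) (volume_sum_level 1)

theorem volume_convexHull_upper_triangle :
    volume (convexHull ℝ {![(1:ℝ),1,0], ![1,0,1], ![0,1,1]}) = 0 := by
  rw [convexHull_upper_triangle]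
  exact measure_mono_null (fun x hx => hx.2.2.2) (volume_sum_level 2)

theorem mixedVol3_diagonal_triangles :
    mixedVol3 (convexHull ℝ {![(0:ℝ),0,0], ![1,1,1]})
      (convexHull ℝ {![(1:ℝ),0,0], ![0,1,0], ![0,0,1]})
      (convexHull ℝ {![(1:ℝ),1,0], ![1,0,1], ![0,1,1]}) = 6 := by
  have h : volume (convexHull ℝ {![(1:ℝ),0,0], ![0,1,0], ![0,0,1]} +
      convexHull ℝ {![(1:ℝ),1,0], ![1,0,1], ![0,1,1]}) = 0 := by
    rw [lower_add_upper_triangle]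
    exact measure_mono_null (fun x hx => hx.2.2.2) (volume_sum_level 3)
  rw [mixedVol3, volume_diagonal_add_triangles, volume_diagonal_add_lower_triangle,
    volume_diagonal_add_upper_triangle, h, volume_convexHull_diagonal,
    volume_convexHull_lower_triangle, volume_convexHull_upper_triangle,
    ENNReal.toReal_ofReal (by norm_num)]
  norm_num

theorem mixedVol3_ne_six_of_volume_le {A B C : Set (Fin 3 → ℝ)} (hA : volume A = 0)
    (hB : volume B = 0) (hC : volume C = 0)
    (h : volume (A + B + C) ≤ ENNReal.ofReal (9/2)) : mixedVol3 A B C ≠ 6 := by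
  have h' := ENNReal.toReal_mono ENNReal.ofReal_ne_top h
  rw [ENNReal.toReal_ofReal (by norm_num)] at h'
  have h1 : 0 ≤ (volume (A + B)).toReal := ENNReal.toReal_nonneg
  have h2 : 0 ≤ (volume (A + C)).toReal := ENNReal.toReal_nonneg
  have h3 : 0 ≤ (volume (B + C)).toReal := ENNReal.toReal_nonneg
  rw [mixedVol3, hA, hB, hC, ENNReal.toReal_zero]
  intro h6
  linarith

/-- The triple `D = ({(0,0,0),(1,1,1)}, {(1,0,0),(0,1,0),(0,0,1)},
{(1,1,0),(1,0,1),(0,1,1)})` is an irreducible fill of `(Q,Q,Q)`, `Q = [0,1]³`: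
each `Dᵢ ⊆ Q`, `M(conv D₁, conv D₂, conv D₃) = M(Q,Q,Q) = 6`, and no triple obtained by
strictly shrinking some `Dᵢ` retains this mixed volume. -/
theorem diagonal_triangles_irreducibly_fill_cube :
    (({![(0:ℝ),0,0], ![1,1,1]} : Set (Fin 3 → ℝ)) ⊆ Set.Icc (0 : Fin 3 → ℝ) 1) ∧
    (({![(1:ℝ),0,0], ![0,1,0], ![0,0,1]} : Set (Fin 3 → ℝ)) ⊆ Set.Icc (0 : Fin 3 → ℝ) 1) ∧
    (({![(1:ℝ),1,0], ![1,0,1], ![0,1,1]} : Set (Fin 3 → ℝ)) ⊆ Set.Icc (0 : Fin 3 → ℝ) 1) ∧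
    mixedVol3 (Set.Icc (0 : Fin 3 → ℝ) 1) (Set.Icc (0 : Fin 3 → ℝ) 1)
      (Set.Icc (0 : Fin 3 → ℝ) 1) = 6 ∧
    mixedVol3 (convexHull ℝ {![(0:ℝ),0,0], ![1,1,1]})
      (convexHull ℝ {![(1:ℝ),0,0], ![0,1,0], ![0,0,1]})
      (convexHull ℝ {![(1:ℝ),1,0], ![1,0,1], ![0,1,1]}) = 6 ∧
    ∀ D₁' D₂' D₃' : Set (Fin 3 → ℝ),
      D₁' ⊆ ({![(0:ℝ),0,0], ![1,1,1]} : Set (Fin 3 → ℝ)) →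
      D₂' ⊆ ({![(1:ℝ),0,0], ![0,1,0], ![0,0,1]} : Set (Fin 3 → ℝ)) →
      D₃' ⊆ ({![(1:ℝ),1,0], ![1,0,1], ![0,1,1]} : Set (Fin 3 → ℝ)) →
      (D₁' ⊂ ({![(0:ℝ),0,0], ![1,1,1]} : Set (Fin 3 → ℝ)) ∨
        D₂' ⊂ ({![(1:ℝ),0,0], ![0,1,0], ![0,0,1]} : Set (Fin 3 → ℝ)) ∨
        D₃' ⊂ ({![(1:ℝ),1,0], ![1,0,1], ![0,1,1]} : Set (Fin 3 → ℝ))) →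
      mixedVol3 (convexHull ℝ D₁') (convexHull ℝ D₂') (convexHull ℝ D₃') ≠ 6 := by
  refine ⟨?_, ?_, ?_, mixedVol3_cube, mixedVol3_diagonal_triangles, ?_⟩
  · rintro x (rfl | rfl) <;> simp [Pi.le_def, Fin.forall_fin_succ]
  · rintro x (rfl | rfl | rfl) <;> simp [Pi.le_def, Fin.forall_fin_succ]
  · rintro x (rfl | rfl | rfl) <;> simp [Pi.le_def, Fin.forall_fin_succ]
  intro D₁ D₂ D₃ h₁ h₂ h₃ h
  have c₁ := convexHull_mono (𝕜 := ℝ) h₁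
  have c₂ := convexHull_mono (𝕜 := ℝ) h₂
  have c₃ := convexHull_mono (𝕜 := ℝ) h₃
  apply mixedVol3_ne_six_of_volume_le (measure_mono_null c₁ volume_convexHull_diagonal)
    (measure_mono_null c₂ volume_convexHull_lower_triangle)
    (measure_mono_null c₃ volume_convexHull_upper_triangle)
  have hdiag : ∀ a ∈ convexHull ℝ D₁, ∃ t : ℝ, a = fun _ => t := by
    intro a ha
    obtain ⟨t, -, h⟩ := (convexHull_diagonal ▸ c₁) ha
    exact ⟨t, h⟩
  have hlower := c₂.trans_eq convexHull_lower_triangle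
  have hupper := c₃.trans_eq convexHull_upper_triangle
  rcases h with h | h | h
  · obtain ⟨v, hv⟩ : ∃ v, D₁ ⊆ {v} := by
      obtain ⟨u, hu, hu'⟩ := Set.exists_of_ssubset h
      rcases hu with rfl | rfl
      · exact ⟨_, fun x hx => (h₁ hx).resolve_left (fun e => hu' (e ▸ hx))⟩
      · exact ⟨_, fun x hx => (h₁ hx).resolve_right (fun e => hu' (e ▸ hx))⟩
    have hv' := (convexHull_mono (𝕜 := ℝ) hv).trans_eq (convexHull_singleton v)
    refine (measure_mono_null ?_ (volume_sum_level (v 0 + v 1 + v 2 + 3))).trans_le zero_le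
    rintro _ ⟨_, ⟨a, ha, b, hb, rfl⟩, c, hc, rfl⟩
    obtain rfl := hv' ha
    have := (hlower hb).2.2.2
    have := (hupper hc).2.2.2
    simp only [Set.mem_ofPred_eq, Pi.add_apply]
    linarith
  · obtain ⟨i, hi⟩ : ∃ i, ∀ x ∈ D₂, x i = 0 := by
      obtain ⟨u, hu, hu'⟩ := Set.exists_of_ssubset h
      rcases hu with rfl | rfl | rfl
      · refine ⟨0, fun x hx => ?_⟩
        rcases h₂ hx with rfl | rfl | rfl <;> simp_all
      · refine ⟨1, fun x hx => ?_⟩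
        rcases h₂ hx with rfl | rfl | rfl <;> simp_all
      · refine ⟨2, fun x hx => ?_⟩
        rcases h₂ hx with rfl | rfl | rfl <;> simp_all
    have hi' : convexHull ℝ D₂ ⊆ {x | x i = 0} :=
      convexHull_min hi (convex_hyperplane (LinearMap.proj (R := ℝ) i).isLinear 0)
    refine (measure_mono ?_).trans_eq (volume_half_prism i _ rfl).1
    refine Set.subset_inter (Set.add_subset_add (Set.add_subset_add c₁ c₂) c₃) ?_
    rintro _ ⟨_, ⟨a, ha, b, hb, rfl⟩, c, hc, rfl⟩
    obtain ⟨t, rfl⟩ := hdiag a ha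
    have hb' : b i = 0 := hi' hb
    have := (hlower hb).2.2.2
    obtain ⟨k0, k1, k2, k3⟩ := hupper hc
    have hc' : c i ≤ 1 := by fin_cases i <;> assumption
    simp only [Set.mem_ofPred_eq, Pi.add_apply]
    linarith
  · obtain ⟨i, hi⟩ : ∃ i, ∀ x ∈ D₃, x i = 1 := by
      obtain ⟨u, hu, hu'⟩ := Set.exists_of_ssubset h
      rcases hu with rfl | rfl | rfl
      · refine ⟨2, fun x hx => ?_⟩
        rcases h₃ hx with rfl | rfl | rfl <;> simp_all
      · refine ⟨1, fun x hx => ?_⟩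
        rcases h₃ hx with rfl | rfl | rfl <;> simp_all
      · refine ⟨0, fun x hx => ?_⟩
        rcases h₃ hx with rfl | rfl | rfl <;> simp_all
    have hi' : convexHull ℝ D₃ ⊆ {x | x i = 1} :=
      convexHull_min hi (convex_hyperplane (LinearMap.proj (R := ℝ) i).isLinear 1)
    refine (measure_mono ?_).trans_eq (volume_half_prism i _ rfl).2
    refine Set.subset_inter (Set.add_subset_add (Set.add_subset_add c₁ c₂) c₃) ?_
    rintro _ ⟨_, ⟨a, ha, b, hb, rfl⟩, c, hc, rfl⟩
    obtain ⟨t, rfl⟩ := hdiag a ha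
    have hc' : c i = 1 := hi' hc
    have := (hupper hc).2.2.2
    obtain ⟨k0, k1, k2, k3⟩ := hlower hb
    have hb' : 0 ≤ b i := by fin_cases i <;> assumption
    simp only [Set.mem_ofPred_eq, Pi.add_apply]
    linarith
end

section
/- Let S = conv{(0,0,0),(1,1,1)}, T₁ = conv{(1,0,0),(0,1,0),(0,0,1)}, and T₂ = conv{(1,1,0),(1,0,1),(0,1,1)} in ℝ³. Then the mixed volume M(S,T₁,T₂) equals 6; concretely, since S, T₁, T₂ each have Lebesgue measure zero, vol(S+T₁+T₂) − vol(S+T₁) − vol(S+T₂) − vol(T₁+T₂) = 6, where + denotes Minkowski sum and vol is Lebesgue measure on ℝ³. -/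
open MeasureTheory Pointwise

/-- The point `c + s • (1, 1, 1) + a • (-1, 1, 0) + b • (-1, 0, 1)` ranges over this set when `s`
ranges over `I` and `(a, b)` over `K`. -/
def diagonalPrism (c : Fin 3 → ℝ) (I : Set ℝ) (K : Set (ℝ × ℝ)) : Set (Fin 3 → ℝ) :=
  {x | ∃ s ∈ I, ∃ k ∈ K, x = c + ![s - k.1 - k.2, s + k.1, s + k.2]}

/-- The right triangle with legs `1` on the coordinate axes. -/
def unitTriangle : Set (ℝ × ℝ) := {k | 0 ≤ k.1 ∧ 0 ≤ k.2 ∧ k.1 + k.2 ≤ 1}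

/-- The difference body of `unitTriangle`. -/
def unitHexagon : Set (ℝ × ℝ) := {k | |k.1| ≤ 1 ∧ |k.2| ≤ 1 ∧ |k.1 + k.2| ≤ 1}

theorem unitTriangle_sub_unitTriangle : unitTriangle - unitTriangle = unitHexagon := by
  ext ⟨a, b⟩
  simp only [Set.mem_sub, Prod.exists, unitTriangle, unitHexagon, Set.mem_ofPred_eq,
    Prod.mk_sub_mk, Prod.mk.injEq, abs_le]
  constructor
  · rintro ⟨p, q, ⟨_, _, _⟩, r, s, ⟨_, _, _⟩, rfl, rfl⟩
    refine ⟨⟨?_, ?_⟩, ⟨?_, ?_⟩, ?_, ?_⟩ <;> linarith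
  · rintro ⟨⟨_, _⟩, ⟨_, _⟩, _, _⟩
    refine ⟨max a 0, max b 0, ?_, max (-a) 0, max (-b) 0, ?_, ?_⟩ <;> grind

theorem isClosed_unitTriangle : IsClosed unitTriangle := by
  unfold unitTriangle
  simp only [Set.ofPred_and]
  exact (isClosed_le (by fun_prop) (by fun_prop)).inter
    ((isClosed_le (by fun_prop) (by fun_prop)).inter (isClosed_le (by fun_prop) (by fun_prop)))

theorem isClosed_unitHexagon : IsClosed unitHexagon := by
  unfold unitHexagon
  simp only [Set.ofPred_and]
  exact (isClosed_le (by fun_prop) (by fun_prop)).inter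
    ((isClosed_le (by fun_prop) (by fun_prop)).inter (isClosed_le (by fun_prop) (by fun_prop)))

/-- The area of a closed planar region bounded by the graphs of two functions over an interval. -/
theorem volume_eq_ofReal_integral_of_slices {K : Set (ℝ × ℝ)} (hK : IsClosed K) {p q : ℝ}
    (hpq : p ≤ q) {f g : ℝ → ℝ} (hf : Continuous f) (hg : Continuous g)
    (hfg : ∀ a ∈ Set.Icc p q, f a ≤ g a)
    (h : ∀ a b, (a, b) ∈ K ↔ a ∈ Set.Icc p q ∧ b ∈ Set.Icc (f a) (g a)) :
    volume K = ENNReal.ofReal (∫ a in p..q, (g a - f a)) := by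
  have hslice (a : ℝ) : volume (Prod.mk a ⁻¹' K) =
      (Set.Icc p q).indicator (fun a => ENNReal.ofReal (g a - f a)) a := by
    by_cases ha : a ∈ Set.Icc p q
    · have : Prod.mk a ⁻¹' K = Set.Icc (f a) (g a) := by ext b; simp [h, ha.1, ha.2]
      rw [this, Real.volume_Icc, Set.indicator_of_mem ha]
    · have : Prod.mk a ⁻¹' K = ∅ := by ext b; simp only [Set.mem_preimage, h, ha]; simp
      rw [this, measure_empty, Set.indicator_of_notMem ha]
  rw [Measure.volume_eq_prod, Measure.prod_apply hK.measurableSet]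
  simp_rw [hslice]
  rw [lintegral_indicator measurableSet_Icc, intervalIntegral.integral_of_le hpq,
    ← integral_Icc_eq_integral_Ioc, ofReal_integral_eq_lintegral_ofReal]
  · exact (hg.sub hf).continuousOn.integrableOn_compact isCompact_Icc
  · filter_upwards [ae_restrict_mem measurableSet_Icc] with a ha
    exact sub_nonneg.2 (hfg a ha)

theorem volume_unitTriangle : volume unitTriangle = ENNReal.ofReal (1 / 2) := by
  rw [volume_eq_ofReal_integral_of_slices isClosed_unitTriangle zero_le_one
    (f := fun _ => 0) (g := fun a => 1 - a) (by fun_prop) (by fun_prop)]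
  · simp only [sub_zero]
    rw [intervalIntegral.integral_sub (by simp) (by simp)]
    norm_num
  · rintro a ⟨_, _⟩
    linarith
  · simp only [unitTriangle, Set.mem_ofPred_eq, Set.mem_Icc]
    grind

theorem volume_unitHexagon : volume unitHexagon = ENNReal.ofReal 3 := by
  rw [volume_eq_ofReal_integral_of_slices isClosed_unitHexagon (p := -1) (q := 1) (by norm_num)
    (f := fun a => max (-1) (-1 - a)) (g := fun a => min 1 (1 - a)) (by fun_prop) (by fun_prop)]
  · congr 1
    have hi (p q : ℝ) : IntervalIntegrable
        (fun a : ℝ => min 1 (1 - a) - max (-1) (-1 - a)) volume p q :=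
      Continuous.intervalIntegrable (by fun_prop) p q
    rw [← intervalIntegral.integral_add_adjacent_intervals (hi (-1) 0) (hi 0 1),
      intervalIntegral.integral_congr (g := fun a => 2 + a) (b := 0),
      intervalIntegral.integral_congr (g := fun a => 2 - a) (a := 0)]
    · rw [intervalIntegral.integral_add (by simp) (by simp),
        intervalIntegral.integral_sub (by simp) (by simp)]
      norm_num
    · intro a ha
      rw [Set.uIcc_of_le (by norm_num)] at ha
      grind
    · intro a ha
      rw [Set.uIcc_of_le (by norm_num)] at ha
      grind
  · rintro a ⟨_, _⟩
    grind
  · simp only [unitHexagon, Set.mem_ofPred_eq, Set.mem_Icc, abs_le]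
    grind

theorem volume_setOf_zero_mem_and_mem (I : Set ℝ) (K : Set (ℝ × ℝ)) :
    volume {y : Fin 3 → ℝ | y 0 ∈ I ∧ (y 1, y 2) ∈ K} = volume I * volume K := by
  have h₁ := (volume_preserving_piFinSuccAbove (fun _ : Fin 3 => ℝ) 0).measure_preimage_equiv
    (I ×ˢ (MeasurableEquiv.finTwoArrow ⁻¹' K))
  have h₂ := (volume_preserving_finTwoArrow ℝ).measure_preimage_equiv K
  rw [Measure.volume_eq_prod, Measure.prod_prod, h₂] at h₁
  exact h₁

theorem volume_diagonalPrism (c : Fin 3 → ℝ) (I : Set ℝ) (K : Set (ℝ × ℝ)) :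
    volume (diagonalPrism c I K) = 3 * (volume I * volume K) := by
  let M : Matrix (Fin 3) (Fin 3) ℝ := !![1, -1, -1; 1, 1, 0; 1, 0, 1]
  have hM : M.det = 3 := by
    simp [M, Matrix.det_fin_three]
    norm_num
  have himage : diagonalPrism c I K = (fun x => c + x) ''
      (Matrix.toLin' M '' {y : Fin 3 → ℝ | y 0 ∈ I ∧ (y 1, y 2) ∈ K}) := by
    ext x
    simp only [diagonalPrism, Set.mem_ofPred_eq, Set.image_image, Set.mem_image]
    have key (s a b : ℝ) : Matrix.toLin' M ![s, a, b] = ![s - a - b, s + a, s + b] := by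
      ext i
      fin_cases i <;> simp [M, Matrix.mulVec, dotProduct, Fin.sum_univ_three]; ring
    constructor
    · rintro ⟨s, hs, ⟨a, b⟩, hk, rfl⟩
      exact ⟨![s, a, b], ⟨hs, hk⟩, by rw [key]⟩
    · rintro ⟨y, ⟨hs, hk⟩, rfl⟩
      refine ⟨y 0, hs, (y 1, y 2), hk, ?_⟩
      rw [← key]
      congr 2
      ext i
      fin_cases i <;> rfl
  rw [himage, Set.image_add_left, measure_preimage_add, Measure.addHaar_image_linearMap,
    LinearMap.det_toLin', hM, volume_setOf_zero_mem_and_mem]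
  norm_num

theorem diagonalPrism_add (c d : Fin 3 → ℝ) (I J : Set ℝ) (K L : Set (ℝ × ℝ)) :
    diagonalPrism c I K + diagonalPrism d J L = diagonalPrism (c + d) (I + J) (K + L) := by
  have key (s t : ℝ) (k l : ℝ × ℝ) :
      c + ![s - k.1 - k.2, s + k.1, s + k.2] + (d + ![t - l.1 - l.2, t + l.1, t + l.2]) =
        c + d + ![(s + t) - (k + l).1 - (k + l).2, (s + t) + (k + l).1, (s + t) + (k + l).2] := by
    ext i
    fin_cases i <;> simp only [Pi.add_apply, Prod.fst_add, Prod.snd_add, Fin.reduceFinMk,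
      Fin.zero_eta, Fin.mk_one, Matrix.cons_val] <;> ring
  ext x
  constructor
  · rintro ⟨_, ⟨s, hs, k, hk, rfl⟩, _, ⟨t, ht, l, hl, rfl⟩, rfl⟩
    exact ⟨s + t, Set.add_mem_add hs ht, k + l, Set.add_mem_add hk hl, key s t k l⟩
  · rintro ⟨_, ⟨s, hs, t, ht, rfl⟩, _, ⟨k, hk, l, hl, rfl⟩, rfl⟩
    exact ⟨_, ⟨s, hs, k, hk, rfl⟩, _, ⟨t, ht, l, hl, rfl⟩, key s t k l⟩

theorem mem_convexHull_triple {E : Type*} [AddCommGroup E] [Module ℝ E] {p q r x : E} :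
    x ∈ convexHull ℝ {p, q, r} ↔
      ∃ k ∈ unitTriangle, x = p + (k.1 • (q - p) + k.2 • (r - p)) := by
  have himage : convexHull ℝ ({p, q, r} : Set E) =
      {x | ∃ k ∈ unitTriangle, x = p + (k.1 • (q - p) + k.2 • (r - p))} := by
    apply subset_antisymm
    · apply convexHull_min
      · rintro x (rfl | rfl | rfl)
        · exact ⟨(0, 0), by norm_num [unitTriangle], by simp⟩
        · exact ⟨(1, 0), by norm_num [unitTriangle], by simp⟩
        · exact ⟨(0, 1), by norm_num [unitTriangle], by simp⟩
      · rintro _ ⟨k, ⟨_, _, _⟩, rfl⟩ _ ⟨l, ⟨_, _, _⟩, rfl⟩ a b ha hb hab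
        obtain rfl : b = 1 - a := by linarith
        refine ⟨a • k + (1 - a) • l, ⟨?_, ?_, ?_⟩, ?_⟩
        · simp only [Prod.fst_add, Prod.smul_fst, smul_eq_mul]
          positivity
        · simp only [Prod.snd_add, Prod.smul_snd, smul_eq_mul]
          positivity
        · simp only [Prod.fst_add, Prod.smul_fst, Prod.snd_add, Prod.smul_snd, smul_eq_mul]
          nlinarith
        · simp only [Prod.fst_add, Prod.smul_fst, Prod.snd_add, Prod.smul_snd, smul_eq_mul]
          module
    · rintro _ ⟨⟨a, b⟩, ⟨ha, hb, hab⟩, rfl⟩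
      have h := (convex_convexHull ℝ {p, q, r}).sum_mem (t := Finset.univ)
        (w := ![1 - a - b, a, b]) (z := ![p, q, r]) ?_ ?_ ?_
      · convert h using 1
        simp only [Fin.sum_univ_three, Matrix.cons_val]
        module
      · intro i _
        fin_cases i <;> simp <;> grind
      · simp only [Fin.sum_univ_three, Matrix.cons_val]
        ring
      · intro i _
        fin_cases i <;> exact subset_convexHull ℝ _ (by simp)
  rw [himage, Set.mem_ofPred_eq]

theorem convexHull_diagonal_eq_diagonalPrism :
    convexHull ℝ ({![(0:ℝ), 0, 0], ![1, 1, 1]} : Set (Fin 3 → ℝ)) =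
      diagonalPrism 0 (Set.Icc 0 1) 0 := by
  rw [convexHull_pair, segment_eq_image]
  ext x
  simp [diagonalPrism, eq_comm]

theorem convexHull_single_eq_diagonalPrism :
    convexHull ℝ ({![(1:ℝ), 0, 0], ![0, 1, 0], ![0, 0, 1]} : Set (Fin 3 → ℝ)) =
      diagonalPrism ![1, 0, 0] 0 unitTriangle := by
  ext x
  rw [mem_convexHull_triple]
  simp [diagonalPrism]
  rfl

theorem convexHull_pairs_eq_diagonalPrism :
    convexHull ℝ ({![(1:ℝ), 1, 0], ![1, 0, 1], ![0, 1, 1]} : Set (Fin 3 → ℝ)) =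
      diagonalPrism ![0, 1, 1] 0 (-unitTriangle) := by
  have hperm : ({![(1:ℝ), 1, 0], ![1, 0, 1], ![0, 1, 1]} : Set (Fin 3 → ℝ)) =
      {![0, 1, 1], ![1, 0, 1], ![1, 1, 0]} := by
    grind
  ext x
  rw [hperm, mem_convexHull_triple]
  simp [diagonalPrism]

/-- The mixed volume of the triple `(S, T₁, T₂)` in `ℝ³`, where `S` is the body diagonal
`conv{(0,0,0),(1,1,1)}` of the unit cube and `T₁ = conv{(1,0,0),(0,1,0),(0,0,1)}`,
`T₂ = conv{(1,1,0),(1,0,1),(0,1,1)}`, equals `6`: since `S`, `T₁`, `T₂` are Lebesgue-null,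
`vol(S+T₁+T₂) - vol(S+T₁) - vol(S+T₂) - vol(T₁+T₂) = 6`. -/
theorem mixedVol_diagonal_triangles :
    (volume (convexHull ℝ ({![(0:ℝ),0,0], ![1,1,1]} : Set (Fin 3 → ℝ)) +
        convexHull ℝ ({![(1:ℝ),0,0], ![0,1,0], ![0,0,1]} : Set (Fin 3 → ℝ)) +
        convexHull ℝ ({![(1:ℝ),1,0], ![1,0,1], ![0,1,1]} : Set (Fin 3 → ℝ)))).toReal -
      (volume (convexHull ℝ ({![(0:ℝ),0,0], ![1,1,1]} : Set (Fin 3 → ℝ)) +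
        convexHull ℝ ({![(1:ℝ),0,0], ![0,1,0], ![0,0,1]} : Set (Fin 3 → ℝ)))).toReal -
      (volume (convexHull ℝ ({![(0:ℝ),0,0], ![1,1,1]} : Set (Fin 3 → ℝ)) +
        convexHull ℝ ({![(1:ℝ),1,0], ![1,0,1], ![0,1,1]} : Set (Fin 3 → ℝ)))).toReal -
      (volume (convexHull ℝ ({![(1:ℝ),0,0], ![0,1,0], ![0,0,1]} : Set (Fin 3 → ℝ)) +
        convexHull ℝ ({![(1:ℝ),1,0], ![1,0,1], ![0,1,1]} : Set (Fin 3 → ℝ)))).toReal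
      = 6 := by
  have hvol : volume (-unitTriangle) = volume unitTriangle := Measure.measure_neg _ _
  rw [convexHull_diagonal_eq_diagonalPrism, convexHull_single_eq_diagonalPrism,
    convexHull_pairs_eq_diagonalPrism]
  have hzero : volume (0 : Set ℝ) = 0 := Real.volume_singleton
  simp only [diagonalPrism_add, volume_diagonalPrism, add_zero, zero_add, ← sub_eq_add_neg, zero_sub,
    unitTriangle_sub_unitTriangle, hvol, hzero, volume_unitTriangle, volume_unitHexagon,
    Real.volume_Icc, ENNReal.toReal_mul]
  norm_num
end
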